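/- Let k ≥ 2, let G be a k-uniform hypergraph, and consider the price competition game constructed from G with its optimal assignment x̂. For every node cover C of G, the price vector p with p_{j*} = k+3 for every auxiliary vendor j*, p_e = (k+1)² for every edge vendor e, p_j = k+2 for every node vendor j with j ∈ C, and p_j = k+3 for every node vendor j with j ∉ C, is such that x̂ is consistent to p, s_j(x̂,p) = 1 for every node vendor j ∈ C, all other subsidies s_{j'}(x̂,p) are 0, and hence the total subsidy cost ∑ s(x̂,p) equals |C|. -/

import Mathlib

open Finset

/-- A price competition game with buyer types `N` and vendors `M`
(including the special "abstain" vendor). -/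
structure PCGame (N M : Type) [Fintype N] [Fintype M] where
  abstain : M
  μ : N → ℝ
  v : N → M → ℝ
  c : M → ℝ
  μ_pos : ∀ i, 0 < μ i
  v_nonneg : ∀ i j, 0 ≤ v i j
  c_nonneg : ∀ j, 0 ≤ c j
  v_abstain : ∀ i, v i abstain = 0
  c_abstain : c abstain = 0

namespace PCGame

variable {N M : Type} [Fintype N] [Fintype M]

/-- `p` is a valid price vector: every price is at least the production cost and
the abstain vendor has price `0`. -/
def IsPrice (G : PCGame N M) (p : M → ℝ) : Prop :=
  (∀ j, G.c j ≤ p j) ∧ p G.abstain = 0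

/-- `x` is a valid buyers-to-vendors assignment. -/
def IsAssignment (G : PCGame N M) (x : N → M → ℝ) : Prop :=
  (∀ i j, 0 ≤ x i j) ∧ ∀ i, ∑ j, x i j = G.μ i

/-- `x` is consistent to `p`: positive volume goes only to utility-maximizing vendors. -/
def Consistent (G : PCGame N M) (x : N → M → ℝ) (p : M → ℝ) : Prop :=
  ∀ i j, 0 < x i j → ∀ j', G.v i j' - p j' ≤ G.v i j - p j

/-- Utility of vendor `j` under assignment `x` and prices `p`. -/
noncomputable def util (G : PCGame N M) (x : N → M → ℝ) (p : M → ℝ) (j : M) : ℝ :=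
  (p j - G.c j) * ∑ i, x i j

/-- Total utility of the buyers of type `i`. -/
noncomputable def buyerUtil (G : PCGame N M) (x : N → M → ℝ) (p : M → ℝ) (i : N) : ℝ :=
  ∑ j, x i j * (G.v i j - p j)

/-- `(x, p)` is a (pure Nash) equilibrium: `x` is consistent to `p` and no (non-abstain)
vendor can increase its utility by deviating to another price. -/
def IsEquilibrium [DecidableEq M] (G : PCGame N M) (x : N → M → ℝ) (p : M → ℝ) : Prop :=
  G.IsPrice p ∧ G.IsAssignment x ∧ G.Consistent x p ∧
    ∀ j, j ≠ G.abstain → ∀ p' : ℝ, G.c j ≤ p' →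
      ∀ y, G.IsAssignment y → G.Consistent y (Function.update p j p') →
        G.util y (Function.update p j p') j ≤ G.util x p j

/-- Social welfare of assignment `x`. -/
noncomputable def SW (G : PCGame N M) (x : N → M → ℝ) : ℝ :=
  ∑ i, ∑ j, x i j * (G.v i j - G.c j)

/-- Optimal social welfare. -/
noncomputable def SWopt (G : PCGame N M) : ℝ :=
  ∑ i, G.μ i * Finset.univ.sup' ⟨G.abstain, Finset.mem_univ _⟩ (fun j => G.v i j - G.c j)

/-- `θ_j(p)`: the supremum utility of vendor `j` over all of its price deviations
(the abstain vendor cannot deviate from price `0`). -/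
noncomputable def theta [DecidableEq M] (G : PCGame N M) (p : M → ℝ) (j : M) : ℝ :=
  sSup {u : ℝ | ∃ (p' : ℝ) (y : N → M → ℝ), G.c j ≤ p' ∧ (j = G.abstain → p' = 0) ∧
    G.IsAssignment y ∧ G.Consistent y (Function.update p j p') ∧
    u = G.util y (Function.update p j p') j}

/-- The minimum subsidy that makes vendor `j` not want to deviate from `(x, p)`. -/
noncomputable def subsidy [DecidableEq M] (G : PCGame N M) (x : N → M → ℝ) (p : M → ℝ)
    (j : M) : ℝ :=
  G.theta p j - G.util x p j

end PCGame

namespace PCGame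

variable {N M : Type} [Fintype N] [Fintype M]

theorem IsAssignment.le_volume {G : PCGame N M} {y : N → M → ℝ} (hy : G.IsAssignment y)
    (i : N) (j : M) : y i j ≤ G.μ i := by
  rw [← hy.2 i]
  exact Finset.single_le_sum (fun j _ => hy.1 i j) (Finset.mem_univ j)

theorem Consistent.eq_zero_of_lt {G : PCGame N M} {y : N → M → ℝ} {p : M → ℝ}
    (hc : G.Consistent y p) (hy : G.IsAssignment y) {i : N} {j j' : M}
    (h : G.v i j - p j < G.v i j' - p j') : y i j = 0 := by
  by_contra hne
  exact absurd (hc i j (lt_of_le_of_ne (hy.1 i j) (Ne.symm hne)) j') (not_le.mpr h)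

/-- A buyer whose valuation is below the deviation price prefers to abstain. -/
theorem Consistent.eq_zero_of_lt_price [DecidableEq M] {G : PCGame N M} {y : N → M → ℝ}
    {p : M → ℝ} {j : M} {q : ℝ} (hc : G.Consistent y (Function.update p j q))
    (hy : G.IsAssignment y) (hp : p G.abstain = 0) (hj : j ≠ G.abstain) {i : N}
    (h : G.v i j < q) : y i j = 0 := by
  apply hc.eq_zero_of_lt hy (j' := G.abstain)
  rw [Function.update_self, Function.update_of_ne hj.symm, hp, G.v_abstain]
  linarith

/-- `θ_j` equals `t` once `t` is attained and bounds every deviation of a non-abstaining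
vendor to a positive price. -/
theorem theta_eq_of_attained [DecidableEq M] {G : PCGame N M} {p : M → ℝ} {j : M} {t q : ℝ}
    {x : N → M → ℝ} (hj : j ≠ G.abstain) (hcost : G.c j = 0) (ht : 0 ≤ t) (hq : 0 ≤ q)
    (hx : G.IsAssignment x) (hxc : G.Consistent x (Function.update p j q))
    (hxt : q * ∑ i, x i j = t)
    (hub : ∀ (r : ℝ) (y : N → M → ℝ), 0 < r → G.IsAssignment y →
      G.Consistent y (Function.update p j r) → r * ∑ i, y i j ≤ t) :
    G.theta p j = t := by
  apply IsGreatest.csSup_eq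
  refine ⟨⟨q, x, by rw [hcost]; exact hq, fun h => absurd h hj, hx, hxc, ?_⟩, ?_⟩
  · simp [util, hcost, hxt]
  · rintro u ⟨r, y, hr, -, hy, hyc, rfl⟩
    rw [hcost] at hr
    simp only [util, hcost, Function.update_self, sub_zero]
    rcases hr.eq_or_lt with rfl | hr
    · simpa using ht
    · exact hub r y hr hy hyc

theorem subsidy_abstain [DecidableEq M] {G : PCGame N M} {x : N → M → ℝ} {p : M → ℝ}
    (hp : p G.abstain = 0) : G.subsidy x p G.abstain = 0 := by
  have hu : G.util x p G.abstain = 0 := by simp [util, hp, G.c_abstain]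
  rw [subsidy, hu, sub_zero, theta]
  apply le_antisymm
  · apply Real.sSup_nonpos
    rintro u ⟨r, y, -, hr, -, -, rfl⟩
    simp [util, hr rfl, G.c_abstain]
  · apply Real.sSup_nonneg
    rintro u ⟨r, y, -, hr, -, -, rfl⟩
    simp [util, hr rfl, G.c_abstain]

end PCGame

/-- in the node-cover game, the prices built from a node cover `C`
make the optimal assignment consistent, give subsidy `1` to each node vendor in `C`
and `0` to all other vendors, for a total subsidy cost of `|C|`.
Buyer types: `Sum.inl e` is `b_e`, `Sum.inr (Sum.inl j)` is `b_j`,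
`Sum.inr (Sum.inr j)` is `b*_j`.  Vendors: `none` is the abstain option,
`some (Sum.inl e)` is the edge vendor `e`, `some (Sum.inr (Sum.inl j))` is the node
vendor `j`, `some (Sum.inr (Sum.inr j))` is the auxiliary vendor `j*`. -/
theorem stmt15 {V : Type} [Fintype V] [DecidableEq V] (k : ℕ) (hk : 2 ≤ k)
    (E : Finset (Finset V)) (hE : ∀ S ∈ E, S.card = k)
    (G : PCGame (↥E ⊕ V ⊕ V) (Option (↥E ⊕ V ⊕ V)))
    (hab : G.abstain = none)
    (hμe : ∀ e : ↥E, G.μ (Sum.inl e) = 1)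
    (hμj : ∀ j : V, G.μ (Sum.inr (Sum.inl j)) = 1)
    (hμs : ∀ j : V, G.μ (Sum.inr (Sum.inr j)) = 1 / ((k : ℝ) + 2))
    (hcost : ∀ m, G.c m = 0)
    (hve : ∀ e e' : ↥E, G.v (Sum.inl e) (some (Sum.inl e')) =
      if e = e' then ((k : ℝ) + 1) ^ 2 else 0)
    (hven : ∀ (e : ↥E) (j : V), G.v (Sum.inl e) (some (Sum.inr (Sum.inl j))) = 0)
    (hvea : ∀ (e : ↥E) (j : V), G.v (Sum.inl e) (some (Sum.inr (Sum.inr j))) = 0)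
    (hvje : ∀ (j : V) (e : ↥E), G.v (Sum.inr (Sum.inl j)) (some (Sum.inl e)) =
      if j ∈ e.1 then (k : ℝ) + 2 else 0)
    (hvjn : ∀ j j' : V, G.v (Sum.inr (Sum.inl j)) (some (Sum.inr (Sum.inl j'))) =
      if j = j' then (k : ℝ) + 3 else 0)
    (hvja : ∀ j j' : V, G.v (Sum.inr (Sum.inl j)) (some (Sum.inr (Sum.inr j'))) = 0)
    (hvse : ∀ (j : V) (e : ↥E), G.v (Sum.inr (Sum.inr j)) (some (Sum.inl e)) = 0)
    (hvsn : ∀ j j' : V, G.v (Sum.inr (Sum.inr j)) (some (Sum.inr (Sum.inl j'))) =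
      if j = j' then (k : ℝ) + 2 else 0)
    (hvsa : ∀ j j' : V, G.v (Sum.inr (Sum.inr j)) (some (Sum.inr (Sum.inr j'))) =
      if j = j' then (k : ℝ) + 3 else 0)
    (xhat : (↥E ⊕ V ⊕ V) → Option (↥E ⊕ V ⊕ V) → ℝ)
    (hxe : ∀ (e : ↥E) m, xhat (Sum.inl e) m = if m = some (Sum.inl e) then 1 else 0)
    (hxj : ∀ (j : V) m, xhat (Sum.inr (Sum.inl j)) m =
      if m = some (Sum.inr (Sum.inl j)) then 1 else 0)
    (hxs : ∀ (j : V) m, xhat (Sum.inr (Sum.inr j)) m =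
      if m = some (Sum.inr (Sum.inr j)) then 1 / ((k : ℝ) + 2) else 0)
    (C : Finset V) (hC : ∀ S ∈ E, ∃ j ∈ C, j ∈ S)
    (p : Option (↥E ⊕ V ⊕ V) → ℝ)
    (hp0 : p none = 0)
    (hpe : ∀ e : ↥E, p (some (Sum.inl e)) = ((k : ℝ) + 1) ^ 2)
    (hpa : ∀ j : V, p (some (Sum.inr (Sum.inr j))) = (k : ℝ) + 3)
    (hpn : ∀ j : V, p (some (Sum.inr (Sum.inl j))) =
      if j ∈ C then (k : ℝ) + 2 else (k : ℝ) + 3) :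
    G.Consistent xhat p ∧
      (∀ j ∈ C, G.subsidy xhat p (some (Sum.inr (Sum.inl j))) = 1) ∧
      (∀ m, (∀ j ∈ C, m ≠ some (Sum.inr (Sum.inl j))) → G.subsidy xhat p m = 0) ∧
      ∑ m, G.subsidy xhat p m = C.card := by
  have hk' : (2 : ℝ) ≤ k := by exact_mod_cast hk
  have hxa : G.IsAssignment xhat := by
    refine ⟨?_, ?_⟩
    · rintro (e | j | j) m
      · rw [hxe]; split_ifs <;> norm_num
      · rw [hxj]; split_ifs <;> norm_num
      · rw [hxs]; split_ifs <;> positivity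
    · rintro (e | j | j)
      · simp [hxe, hμe]
      · simp [hxj, hμj]
      · simp [hxs, hμs]
  have hv0 : ∀ i, G.v i none = 0 := fun i => hab ▸ G.v_abstain i
  have hpab : p G.abstain = 0 := by rw [hab, hp0]
  -- consistency does not depend on which node vendors charge `k + 2`
  have hcons : ∀ q : Option (↥E ⊕ V ⊕ V) → ℝ, q none = 0 →
      (∀ e : ↥E, q (some (Sum.inl e)) = ((k : ℝ) + 1) ^ 2) →
      (∀ j : V, q (some (Sum.inr (Sum.inr j))) = (k : ℝ) + 3) →
      (∀ j : V, (k : ℝ) + 2 ≤ q (some (Sum.inr (Sum.inl j))) ∧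
        q (some (Sum.inr (Sum.inl j))) ≤ k + 3) → G.Consistent xhat q := by
    intro q hq0 hqe hqa hqn i m hpos m'
    rcases i with e | j | j
    · have hm : m = some (Sum.inl e) := by
        by_contra h; simp [hxe, h] at hpos
      subst hm
      rcases m' with _ | e' | j' | j'
      · simp [hv0, hq0, hqe, hve]
      · simp only [hve, hqe]; split_ifs <;> simp_all; positivity
      · have := hqn j'; simp only [hve, hqe, hven, if_true]; linarith
      · simp only [hve, hqe, hvea, hqa, if_true]; linarith
    · have hm : m = some (Sum.inr (Sum.inl j)) := by
        by_contra h; simp [hxj, h] at hpos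
      subst hm
      have hj := hqn j
      rcases m' with _ | e' | j' | j'
      · simp only [hv0, hq0, hvjn, if_true]; linarith
      · simp only [hvje, hqe, hvjn, if_true]; split_ifs <;> nlinarith
      · have := hqn j'
        by_cases h : j = j'
        · subst h; exact le_rfl
        · simp only [hvjn, h, if_true, if_false]; linarith
      · simp only [hvjn, hvja, hqa, if_true]; linarith
    · have hm : m = some (Sum.inr (Sum.inr j)) := by
        by_contra h; simp [hxs, h] at hpos
      subst hm
      rcases m' with _ | e' | j' | j'
      · simp only [hv0, hq0, hvsa, hqa, if_true]; linarith
      · simp only [hvse, hqe, hvsa, hqa, if_true]; nlinarith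
      · have := hqn j'
        simp only [hvsn, hvsa, hqa, if_true]; split_ifs <;> linarith
      · simp only [hvsa, hqa, if_true]; split_ifs <;> linarith
  have hpn' : ∀ j : V, (k : ℝ) + 2 ≤ p (some (Sum.inr (Sum.inl j))) ∧
      p (some (Sum.inr (Sum.inl j))) ≤ k + 3 := by
    intro j; rw [hpn]; split_ifs <;> constructor <;> linarith
  have hcx : G.Consistent xhat p := hcons p hp0 hpe hpa hpn'
  have hxsum_n : ∀ j : V, ∑ i, xhat i (some (Sum.inr (Sum.inl j))) = 1 := by
    intro j; simp [Fintype.sum_sum_type, hxe, hxj, hxs]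
  have hxsum_a : ∀ j : V, ∑ i, xhat i (some (Sum.inr (Sum.inr j))) = 1 / ((k : ℝ) + 2) := by
    intro j; simp [Fintype.sum_sum_type, hxe, hxj, hxs]
  have hxsum_e : ∀ e : ↥E, ∑ i, xhat i (some (Sum.inl e)) = 1 := by
    intro e; simp [Fintype.sum_sum_type, hxe, hxj, hxs]
  have hthn : ∀ j : V, G.theta p (some (Sum.inr (Sum.inl j))) = (k : ℝ) + 3 := by
    intro j
    have hne : some (Sum.inr (Sum.inl j)) ≠ G.abstain := by simp [hab]
    refine PCGame.theta_eq_of_attained (q := (k : ℝ) + 3) (x := xhat) hne (hcost _)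
      (by positivity) (by positivity) hxa ?_ (by rw [hxsum_n, mul_one]) ?_
    · apply hcons
      · simp [hp0]
      · simp [hpe]
      · simp [hpa]
      · intro j'
        by_cases h : j' = j
        · subst h; norm_num
        · simpa [Function.update_of_ne, h] using hpn' j'
    · intro r y hr hy hyc
      have hz : ∀ {i}, G.v i (some (Sum.inr (Sum.inl j))) < r →
          y i (some (Sum.inr (Sum.inl j))) = 0 :=
        fun h => hyc.eq_zero_of_lt_price hy hpab hne h
      have h1 : ∀ e : ↥E, y (Sum.inl e) (some (Sum.inr (Sum.inl j))) = 0 :=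
        fun e => hz (by rw [hven]; exact hr)
      have h2 : ∑ j', y (Sum.inr (Sum.inl j')) (some (Sum.inr (Sum.inl j))) =
          y (Sum.inr (Sum.inl j)) (some (Sum.inr (Sum.inl j))) :=
        Fintype.sum_eq_single j fun j' h => hz (by simpa [hvjn, h] using hr)
      have h3 : ∑ j', y (Sum.inr (Sum.inr j')) (some (Sum.inr (Sum.inl j))) =
          y (Sum.inr (Sum.inr j)) (some (Sum.inr (Sum.inl j))) :=
        Fintype.sum_eq_single j fun j' h => hz (by simpa [hvsn, h] using hr)
      have hb2 := hy.le_volume (Sum.inr (Sum.inl j)) (some (Sum.inr (Sum.inl j)))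
      have hb3 := hy.le_volume (Sum.inr (Sum.inr j)) (some (Sum.inr (Sum.inl j)))
      rw [hμj] at hb2
      rw [hμs] at hb3
      simp only [Fintype.sum_sum_type, h1, h2, h3, Finset.sum_const_zero, zero_add]
      rcases le_or_gt r ((k : ℝ) + 2) with hr2 | hr2
      · calc _ ≤ r * (1 + 1 / ((k : ℝ) + 2)) := by gcongr
          _ ≤ ((k : ℝ) + 2) * (1 + 1 / ((k : ℝ) + 2)) := by gcongr
          _ = _ := by field_simp; ring
      · rw [hz (i := Sum.inr (Sum.inr j)) (by simpa [hvsn] using hr2), add_zero]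
        rcases le_or_gt r ((k : ℝ) + 3) with hr3 | hr3
        · nlinarith
        · rw [hz (by simpa [hvjn] using hr3)]; linarith
  have htha : ∀ j : V, G.theta p (some (Sum.inr (Sum.inr j))) =
      ((k : ℝ) + 3) * (1 / ((k : ℝ) + 2)) := by
    intro j
    have hne : some (Sum.inr (Sum.inr j)) ≠ G.abstain := by simp [hab]
    refine PCGame.theta_eq_of_attained (q := (k : ℝ) + 3) (x := xhat) hne (hcost _)
      (by positivity) (by positivity) hxa ?_ (by rw [hxsum_a]) ?_
    · rw [← hpa j, Function.update_eq_self]; exact hcx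
    · intro r y hr hy hyc
      have hz : ∀ {i}, G.v i (some (Sum.inr (Sum.inr j))) < r →
          y i (some (Sum.inr (Sum.inr j))) = 0 :=
        fun h => hyc.eq_zero_of_lt_price hy hpab hne h
      have h1 : ∀ e : ↥E, y (Sum.inl e) (some (Sum.inr (Sum.inr j))) = 0 :=
        fun e => hz (by rw [hvea]; exact hr)
      have h2 : ∀ j', y (Sum.inr (Sum.inl j')) (some (Sum.inr (Sum.inr j))) = 0 :=
        fun j' => hz (by rw [hvja]; exact hr)
      have h3 : ∑ j', y (Sum.inr (Sum.inr j')) (some (Sum.inr (Sum.inr j))) =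
          y (Sum.inr (Sum.inr j)) (some (Sum.inr (Sum.inr j))) :=
        Fintype.sum_eq_single j fun j' h => hz (by simpa [hvsa, h] using hr)
      have hb3 := hy.le_volume (Sum.inr (Sum.inr j)) (some (Sum.inr (Sum.inr j)))
      rw [hμs] at hb3
      simp only [Fintype.sum_sum_type, h1, h2, h3, Finset.sum_const_zero, zero_add]
      rcases le_or_gt r ((k : ℝ) + 3) with hr3 | hr3
      · gcongr
        exact hy.1 _ _
      · rw [hz (by simpa [hvsa] using hr3), mul_zero]; positivity
  have hthe : ∀ e : ↥E, G.theta p (some (Sum.inl e)) = ((k : ℝ) + 1) ^ 2 := by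
    intro e
    have hne : some (Sum.inl e) ≠ G.abstain := by simp [hab]
    refine PCGame.theta_eq_of_attained (q := ((k : ℝ) + 1) ^ 2) (x := xhat) hne (hcost _)
      (by positivity) (by positivity) hxa ?_ (by rw [hxsum_e, mul_one]) ?_
    · rw [← hpe e, Function.update_eq_self]; exact hcx
    · intro r y hr hy hyc
      have hz : ∀ {i}, G.v i (some (Sum.inl e)) < r → y i (some (Sum.inl e)) = 0 :=
        fun h => hyc.eq_zero_of_lt_price hy hpab hne h
      have h1 : ∑ e' : ↥E, y (Sum.inl e') (some (Sum.inl e)) =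
          y (Sum.inl e) (some (Sum.inl e)) :=
        Fintype.sum_eq_single e fun e' h => hz (by rw [hve, if_neg h]; exact hr)
      have h2 : ∑ j, y (Sum.inr (Sum.inl j)) (some (Sum.inl e)) =
          ∑ j ∈ e.1, y (Sum.inr (Sum.inl j)) (some (Sum.inl e)) := by
        symm
        exact Finset.sum_subset (Finset.subset_univ _)
          fun j _ h => hz (by rw [hvje, if_neg h]; exact hr)
      have h3 : ∀ j, y (Sum.inr (Sum.inr j)) (some (Sum.inl e)) = 0 :=
        fun j => hz (by rw [hvse]; exact hr)
      have hb1 := hy.le_volume (Sum.inl e) (some (Sum.inl e))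
      have hb2 : ∀ j, y (Sum.inr (Sum.inl j)) (some (Sum.inl e)) ≤ 1 :=
        fun j => hμj j ▸ hy.le_volume _ _
      rw [hμe] at hb1
      simp only [Fintype.sum_sum_type, h1, h2, h3, Finset.sum_const_zero, add_zero]
      have hcard : e.1.card = k := hE e.1 e.2
      rcases le_or_gt r ((k : ℝ) + 1) with hr1 | hr1
      · have hs : ∑ j ∈ e.1, y (Sum.inr (Sum.inl j)) (some (Sum.inl e)) ≤ k := by
          have := Finset.sum_le_card_nsmul e.1 _ 1 fun j _ => hb2 j
          simpa [hcard] using this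
        nlinarith
      rcases le_or_gt r ((k : ℝ) + 2) with hr2 | hr2
      · obtain ⟨j₀, hj₀C, hj₀e⟩ := hC e.1 e.2
        have hj₀ : y (Sum.inr (Sum.inl j₀)) (some (Sum.inl e)) = 0 := by
          apply hyc.eq_zero_of_lt hy (j' := some (Sum.inr (Sum.inl j₀)))
          rw [Function.update_self, Function.update_of_ne (by simp), hvje, if_pos hj₀e, hvjn,
            if_pos rfl, hpn, if_pos hj₀C]
          linarith
        have hs : ∑ j ∈ e.1, y (Sum.inr (Sum.inl j)) (some (Sum.inl e)) ≤ (k : ℝ) - 1 := by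
          rw [← Finset.add_sum_erase _ _ hj₀e, hj₀, zero_add]
          have := Finset.sum_le_card_nsmul (e.1.erase j₀) _ 1 fun j _ => hb2 j
          rw [Finset.card_erase_of_mem hj₀e, hcard] at this
          simpa [Nat.cast_sub (show 1 ≤ k by omega)] using this
        nlinarith
      · rw [Finset.sum_eq_zero fun j hj => hz (by rw [hvje, if_pos hj]; exact hr2), add_zero]
        rcases le_or_gt r (((k : ℝ) + 1) ^ 2) with hr3 | hr3
        · nlinarith
        · rw [hz (by simpa [hve] using hr3), mul_zero]; positivity
  have hsn : ∀ j : V, G.subsidy xhat p (some (Sum.inr (Sum.inl j))) =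
      if j ∈ C then 1 else 0 := by
    intro j
    rw [PCGame.subsidy, hthn, PCGame.util, hcost, hxsum_n, hpn]
    split_ifs <;> ring
  have hsa : ∀ j : V, G.subsidy xhat p (some (Sum.inr (Sum.inr j))) = 0 := by
    intro j
    rw [PCGame.subsidy, htha, PCGame.util, hcost, hxsum_a, hpa]
    ring
  have hse : ∀ e : ↥E, G.subsidy xhat p (some (Sum.inl e)) = 0 := by
    intro e
    rw [PCGame.subsidy, hthe, PCGame.util, hcost, hxsum_e, hpe]
    ring
  have hs0 : G.subsidy xhat p none = 0 := by
    rw [← hab]; exact PCGame.subsidy_abstain hpab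
  refine ⟨hcx, fun j hj => by rw [hsn, if_pos hj], ?_, ?_⟩
  · rintro (_ | e | j | j) hm
    · exact hs0
    · exact hse e
    · rw [hsn, if_neg fun hj => hm j hj rfl]
    · exact hsa j
  · simp [Fintype.sum_option, Fintype.sum_sum_type, hs0, hse, hsn, hsa]
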